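/- Let d be an admissible sequence and a an admissible family. Then for every real s > 0 the series G(s) = Σ_{m≥0} Σ_{n∈ℤ} c^{2n+m} q^{n-m/2} d_m a(n,m) · Σ_{l : l ≥ l₁, n < l ≤ n+m} (c^{-1}α^{-1})^l q^{l/2} (q^{sm} - q^{s(|n+m|+|n|)}) converges absolutely (inner sums over empty ranges being 0), and lim_{s→0⁺} s·G(s) = 0. -/

import Mathlib

open Filter Topology

noncomputable section

/-- `qc q x` is the real power `q ^ x`, viewed as a complex number. -/
def qc (q : ℝ) (x : ℝ) : ℂ := ((q ^ x : ℝ) : ℂ)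

/-- An admissible sequence: `d m = q^(m/2) (c₁ c^m + c₂ c^(-m))` for all `m ≥ l₁`. -/
def IsAdmissibleSeq (q : ℝ) (c : ℂ) (l₁ : ℤ) (d : ℕ → ℂ) : Prop :=
  ∃ c₁ c₂ : ℂ, ∀ m : ℕ, l₁ ≤ (m : ℤ) →
    d m = qc q ((m : ℝ) / 2) * (c₁ * c ^ (m : ℤ) + c₂ * c ^ (-(m : ℤ)))

/-- An admissible family on `ℤ × ℕ`, given by region asymptotics. -/
def IsAdmissibleFam (q : ℝ) (l₁ : ℤ) (a : ℤ → ℕ → ℂ) : Prop :=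
  ∃ (k₁ k₂ k₃ : ℂ) (A B : ℤ → ℂ), ∀ (n : ℤ) (m : ℕ),
    (l₁ ≤ n → a n m = k₁) ∧
    (-l₁ < n → n < l₁ → l₁ ≤ n + (m : ℤ) → a n m = A n) ∧
    (n ≤ -l₁ → l₁ ≤ n + (m : ℤ) → a n m = qc q (-(n : ℝ)) * k₂) ∧
    (n ≤ -l₁ → -l₁ < n + (m : ℤ) → n + (m : ℤ) < l₁ →
      a n m = qc q (-(n : ℝ)) * B (n + m)) ∧
    (n + (m : ℤ) ≤ -l₁ → a n m = qc q (-(2 * (n : ℝ) + (m : ℝ))) * k₃)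

/-- An `l`-stabilized family on `ℤ × ℕ` (the regions do not depend on `l`). -/
def IsStabilizedFam (q : ℝ) (c : ℂ) (l₁ : ℤ) (e : ℤ → ℕ → ℂ) : Prop :=
  ∃ (u w : ℂ) (f v : ℤ → ℂ) (N : ℤ), 2 * l₁ < N ∧ ∀ (n : ℤ) (m : ℕ),
    (l₁ ≤ n → e n m = (c ^ 2 * (q : ℂ)) ^ n * (c * qc q (1 / 2)) ^ m * u) ∧
    (-l₁ < n → n < l₁ → N ≤ (m : ℤ) → e n m = (c * qc q (1 / 2)) ^ m * f n) ∧
    (n ≤ -l₁ → -l₁ < n + (m : ℤ) → n + (m : ℤ) < l₁ → N ≤ (m : ℤ) →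
      e n m = qc q ((m : ℝ) / 2) * c ^ (-(m : ℤ)) * v (n + m)) ∧
    (n + (m : ℤ) ≤ -l₁ → e n m = (c ^ 2 * (q : ℂ)⁻¹) ^ n * (c * qc q (-(1 / 2))) ^ m * w)

theorem norm_qc {q : ℝ} (hq : 0 < q) (x : ℝ) : ‖qc q x‖ = q ^ x := by
  rw [qc, Complex.norm_real, Real.norm_of_nonneg (Real.rpow_pos_of_pos hq x).le]

theorem IsAdmissibleSeq.exists_norm_le {q : ℝ} {c : ℂ} {l₁ : ℤ} {d : ℕ → ℂ} (hq : 0 < q)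
    (hc : ‖c‖ = 1) (hd : IsAdmissibleSeq q c l₁ d) :
    ∃ C : ℝ, 0 ≤ C ∧ ∀ m : ℕ, ‖d m‖ ≤ C * q ^ ((m : ℝ) / 2) := by
  obtain ⟨c₁, c₂, h⟩ := hd
  have hpos : ∀ m : ℕ, 0 < q ^ ((m : ℝ) / 2) := fun m => Real.rpow_pos_of_pos hq _
  have hterm : ∀ m : ℕ, 0 ≤ ‖d m‖ / q ^ ((m : ℝ) / 2) :=
    fun m => div_nonneg (norm_nonneg _) (hpos m).le
  have hsum : 0 ≤ ∑ m ∈ Finset.range l₁.toNat, ‖d m‖ / q ^ ((m : ℝ) / 2) :=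
    Finset.sum_nonneg fun m _ => hterm m
  refine ⟨‖c₁‖ + ‖c₂‖ + ∑ m ∈ Finset.range l₁.toNat, ‖d m‖ / q ^ ((m : ℝ) / 2),
    by positivity, fun m => ?_⟩
  rw [← div_le_iff₀ (hpos m)]
  by_cases hm : l₁ ≤ (m : ℤ)
  · have hle : ‖c₁ * c ^ (m : ℤ) + c₂ * c ^ (-(m : ℤ))‖ ≤ ‖c₁‖ + ‖c₂‖ := by
      refine (norm_add_le _ _).trans (le_of_eq ?_)
      simp only [norm_mul, norm_zpow, hc, one_zpow, mul_one]
    rw [h m hm, norm_mul, norm_qc hq, mul_div_cancel_left₀ _ (hpos m).ne']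
    linarith
  · have hle := Finset.single_le_sum (fun m _ => hterm m)
      (Finset.mem_range.2 (show m < l₁.toNat by omega))
    linarith [norm_nonneg c₁, norm_nonneg c₂]

theorem IsAdmissibleFam.exists_norm_le {q : ℝ} {l₁ : ℤ} {a : ℤ → ℕ → ℂ}
    (hl₁ : 0 < l₁) (ha : IsAdmissibleFam q l₁ a) :
    ∃ C : ℝ, 0 ≤ C ∧ ∀ (n : ℤ) (m : ℕ), 0 < n → l₁ ≤ n + m → ‖a n m‖ ≤ C := by
  obtain ⟨k₁, k₂, k₃, A, B, h⟩ := ha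
  have hsum : 0 ≤ ∑ n ∈ Finset.Ico 1 l₁, ‖A n‖ := Finset.sum_nonneg fun n _ => norm_nonneg _
  refine ⟨‖k₁‖ + ∑ n ∈ Finset.Ico 1 l₁, ‖A n‖, by positivity, fun n m hn hnm => ?_⟩
  obtain ⟨h₁, h₂, -⟩ := h n m
  rcases le_or_gt l₁ n with hln | hln
  · rw [h₁ hln]
    linarith
  · rw [h₂ (by omega) hln hnm]
    have hle := Finset.single_le_sum (f := fun n => ‖A n‖) (fun n _ => norm_nonneg _)
      (Finset.mem_Ico.2 (show 1 ≤ n ∧ n < l₁ by omega))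
    linarith [norm_nonneg k₁]

theorem summable_int_of_natAbs {f : ℕ → ℝ} (hf : Summable f) :
    Summable fun n : ℤ => f n.natAbs :=
  Summable.of_nat_of_neg (by simpa using hf) (by simpa using hf)

theorem exists_sum_rpow_half_le {q : ℝ} (hq0 : 0 < q) (hq1 : q < 1) :
    ∃ M : ℝ, 0 ≤ M ∧ ∀ S : Finset ℤ, (∀ l ∈ S, 0 ≤ l) → ∑ l ∈ S, q ^ ((l : ℝ) / 2) ≤ M := by
  have hr0 : 0 ≤ q ^ (1 / 2 : ℝ) := (Real.rpow_pos_of_pos hq0 _).le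
  have hr1 : q ^ (1 / 2 : ℝ) < 1 := Real.rpow_lt_one hq0.le hq1 (by norm_num)
  have hs := summable_int_of_natAbs (summable_geometric_of_lt_one hr0 hr1)
  refine ⟨∑' l : ℤ, (q ^ (1 / 2 : ℝ)) ^ l.natAbs, tsum_nonneg fun l => pow_nonneg hr0 _,
    fun S hS => ?_⟩
  refine le_trans (Finset.sum_le_sum fun l hl => le_of_eq ?_)
    (hs.sum_le_tsum S fun l _ => pow_nonneg hr0 _)
  lift l to ℕ using hS l hl
  rw [← Real.rpow_mul_natCast hq0.le]
  simp only [Int.natAbs_natCast, Int.cast_natCast]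
  congr 1
  ring

/-- The difference of the two exponential weights vanishes unless `n` is positive, in which case
it is `O(s)`. -/
theorem norm_qc_sub_qc_le {q : ℝ} (hq0 : 0 < q) (hq1 : q < 1) {s : ℝ} (hs : 0 < s) {n : ℤ}
    (hn : 0 < n) (m : ℕ) :
    ‖qc q (s * (m : ℝ)) - qc q (s * (((|n + (m : ℤ)| : ℤ) : ℝ) + ((|n| : ℤ) : ℝ)))‖ ≤
      (q ^ s) ^ m * (2 * s * n * -Real.log q) := by
  have hnR : (0 : ℝ) < n := by exact_mod_cast hn
  rw [abs_of_pos hn, abs_of_pos (show 0 < n + (m : ℤ) by omega)]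
  have hfac : qc q (s * (m : ℝ)) - qc q (s * (((n + (m : ℤ) : ℤ) : ℝ) + (n : ℝ))) =
      (((q ^ s) ^ m * (1 - q ^ (2 * s * n)) : ℝ) : ℂ) := by
    have he : s * (((n + (m : ℤ) : ℤ) : ℝ) + (n : ℝ)) = s * m + 2 * s * n := by
      push_cast
      ring
    rw [he, qc, qc, Real.rpow_add hq0, ← Real.rpow_mul_natCast hq0.le]
    push_cast
    ring
  have hle : q ^ (2 * s * n) ≤ 1 := Real.rpow_le_one hq0.le hq1.le (by positivity)
  have hpow : 0 ≤ (q ^ s) ^ m := pow_nonneg (Real.rpow_pos_of_pos hq0 s).le m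
  rw [hfac, Complex.norm_real, Real.norm_of_nonneg (mul_nonneg hpow (by linarith))]
  refine mul_le_mul_of_nonneg_left ?_ hpow
  have hexp := Real.add_one_le_exp (Real.log q * (2 * s * n))
  rw [← Real.rpow_def_of_pos hq0] at hexp
  linarith

theorem qc_sub_qc_eq_zero (q s : ℝ) {n : ℤ} (hn : n ≤ 0) {m : ℕ} (hnm : 0 ≤ n + m) :
    qc q (s * (m : ℝ)) - qc q (s * (((|n + (m : ℤ)| : ℤ) : ℝ) + ((|n| : ℤ) : ℝ))) = 0 := by
  rw [abs_of_nonpos hn, abs_of_nonneg hnm]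
  push_cast
  rw [sub_eq_zero]
  congr 2
  ring

theorem div_one_sub_rpow_le {q : ℝ} (hq0 : 0 < q) (hq1 : q < 1) {s : ℝ} (hs : 0 < s) :
    s * (1 - q ^ s)⁻¹ ≤ (1 + s * -Real.log q) / -Real.log q := by
  have hL : 0 < -Real.log q := neg_pos.2 (Real.log_neg hq0 hq1)
  have hlt : q ^ s < 1 := Real.rpow_lt_one hq0.le hq1 hs
  have hq : 0 < q ^ s := Real.rpow_pos_of_pos hq0 s
  have hexp := Real.add_one_le_exp (Real.log q * -s)
  rw [← Real.rpow_def_of_pos hq0, Real.rpow_neg hq0.le] at hexp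
  have hmul := mul_le_mul_of_nonneg_left hexp hq.le
  rw [mul_inv_cancel₀ hq.ne'] at hmul
  rw [← div_eq_mul_inv, div_le_div_iff₀ (by linarith) hL]
  nlinarith

/-- component of claim (3) with `l ≥ l₁` and `n < l ≤ n + m`. -/
theorem stmt12 (q : ℝ) (hq0 : 0 < q) (hq1 : q < 1) (c α : ℂ)
    (hc : ‖c‖ = 1) (hα : ‖α‖ = 1) (l₁ : ℤ) (hl₁ : 0 < l₁)
    (d : ℕ → ℂ) (hd : IsAdmissibleSeq q c l₁ d)
    (a : ℤ → ℕ → ℂ) (ha : IsAdmissibleFam q l₁ a)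
    (T : ℝ → ℤ × ℕ → ℂ)
    (hT : ∀ (s : ℝ) (n : ℤ) (m : ℕ),
      T s (n, m) = c ^ (2 * n + (m : ℤ)) * qc q ((n : ℝ) - (m : ℝ) / 2) * d m * a n m *
        ∑ l ∈ Finset.Icc (max l₁ (n + 1)) (n + (m : ℤ)),
          (c⁻¹ * α⁻¹) ^ l * qc q ((l : ℝ) / 2) *
            (qc q (s * (m : ℝ)) -
             qc q (s * (((|n + (m : ℤ)| : ℤ) : ℝ) + ((|n| : ℤ) : ℝ))))) :
    (∀ s : ℝ, 0 < s → Summable fun p : ℤ × ℕ => ‖T s p‖) ∧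
    Tendsto (fun s : ℝ => (s : ℂ) * ∑' p : ℤ × ℕ, T s p)
      (𝓝[>] (0 : ℝ)) (𝓝 0) := by
  obtain ⟨D, hD0, hD⟩ := hd.exists_norm_le hq0 hc
  obtain ⟨K, hK0, hK⟩ := ha.exists_norm_le hl₁
  obtain ⟨M, hM0, hM⟩ := exists_sum_rpow_half_le hq0 hq1
  have hL : 0 < -Real.log q := neg_pos.2 (Real.log_neg hq0 hq1)
  set L := -Real.log q with hLdef
  set g : ℤ → ℝ := fun n => (n.natAbs : ℝ) * q ^ n.natAbs with hg
  have hg0 : ∀ n, 0 ≤ g n := fun n => by positivity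
  have hgs : Summable g := by
    refine summable_int_of_natAbs (f := fun k : ℕ => (k : ℝ) * q ^ k) ?_
    simpa using summable_pow_mul_geometric_of_norm_lt_one 1
      (show ‖q‖ < 1 by rwa [Real.norm_of_nonneg hq0.le])
  set E : ℝ := D * K * M * (2 * L) with hE
  have hE0 : 0 ≤ E := by positivity
  have bound : ∀ s : ℝ, 0 < s → ∀ p : ℤ × ℕ,
      ‖T s p‖ ≤ E * s * (g p.1 * (q ^ s) ^ p.2) := by
    rintro s hs ⟨n, m⟩
    have hqs : 0 ≤ q ^ s := (Real.rpow_pos_of_pos hq0 s).le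
    have hrhs : 0 ≤ E * s * (g n * (q ^ s) ^ m) :=
      mul_nonneg (mul_nonneg hE0 hs.le) (mul_nonneg (hg0 n) (pow_nonneg hqs m))
    rw [hT, ← Finset.sum_mul]
    rcases lt_or_ge (n + (m : ℤ)) l₁ with hnm | hnm
    · rw [Finset.Icc_eq_empty (by simp only [max_le_iff]; omega)]
      simpa using hrhs
    rcases le_or_gt n 0 with hn | hn
    · rw [qc_sub_qc_eq_zero q s hn (by omega)]
      simpa using hrhs
    have hsum : ‖∑ l ∈ Finset.Icc (max l₁ (n + 1)) (n + (m : ℤ)),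
        (c⁻¹ * α⁻¹) ^ l * qc q ((l : ℝ) / 2)‖ ≤ M := by
      refine (norm_sum_le _ _).trans (le_trans (le_of_eq ?_)
        (hM (Finset.Icc (max l₁ (n + 1)) (n + (m : ℤ))) fun l hl => ?_))
      · refine Finset.sum_congr rfl fun l _ => ?_
        simp [norm_qc hq0, hc, hα]
      · have := (max_le_iff.1 (Finset.mem_Icc.1 hl).1).1
        omega
    have hgn : g n = n * q ^ (n : ℝ) := by
      lift n to ℕ using hn.le
      simp [hg]
    have hqn : 0 < q ^ ((n : ℝ) - (m : ℝ) / 2) := Real.rpow_pos_of_pos hq0 _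
    have hqm : 0 < q ^ ((m : ℝ) / 2) := Real.rpow_pos_of_pos hq0 _
    have hdiff := norm_qc_sub_qc_le hq0 hq1 hs hn m
    rw [← hLdef] at hdiff
    rw [norm_mul, norm_mul, norm_mul, norm_mul, norm_mul, norm_zpow, hc, one_zpow, one_mul,
      norm_qc hq0]
    calc _ ≤ q ^ ((n : ℝ) - (m : ℝ) / 2) * (D * q ^ ((m : ℝ) / 2)) * K *
          (M * ((q ^ s) ^ m * (2 * s * n * L))) := by
          gcongr
          · exact hD m
          · exact hK n m hn hnm
      _ = E * s * (g n * (q ^ s) ^ m) := by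
          have : q ^ (n : ℝ) = q ^ ((n : ℝ) - (m : ℝ) / 2) * q ^ ((m : ℝ) / 2) := by
            rw [← Real.rpow_add hq0, sub_add_cancel]
          rw [hgn, this, hE]
          ring
  have hgeom : ∀ s : ℝ, 0 < s → HasSum (fun p : ℤ × ℕ => E * s * (g p.1 * (q ^ s) ^ p.2))
      (E * s * ((∑' n, g n) * (1 - q ^ s)⁻¹)) := by
    intro s hs
    have hqs : 0 ≤ q ^ s := (Real.rpow_pos_of_pos hq0 s).le
    have hlt : q ^ s < 1 := Real.rpow_lt_one hq0.le hq1 hs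
    have hgeo := hasSum_geometric_of_lt_one hqs hlt
    exact (hgs.hasSum.mul hgeo (hgs.mul_of_nonneg hgeo.summable hg0
      fun m => pow_nonneg hqs m)).mul_left _
  refine ⟨fun s hs => Summable.of_nonneg_of_le (fun p => norm_nonneg _) (bound s hs)
    (hgeom s hs).summable, ?_⟩
  have hG0 : 0 ≤ ∑' n, g n := tsum_nonneg hg0
  have hlim : Tendsto (fun s : ℝ => E * s * ((∑' n, g n) * ((1 + s * L) / L)))
      (𝓝[>] (0 : ℝ)) (𝓝 0) := by
    have hcont : Continuous fun s : ℝ => E * s * ((∑' n, g n) * ((1 + s * L) / L)) := by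
      fun_prop
    simpa using (hcont.tendsto 0).mono_left nhdsWithin_le_nhds
  refine squeeze_zero_norm' ?_ hlim
  filter_upwards [self_mem_nhdsWithin] with s hs
  have hs : 0 < s := hs
  rw [norm_mul, Complex.norm_real, Real.norm_of_nonneg hs.le]
  calc s * ‖∑' p, T s p‖ ≤ s * (E * s * ((∑' n, g n) * (1 - q ^ s)⁻¹)) := by
        gcongr
        exact tsum_of_norm_bounded (hgeom s hs) (bound s hs)
    _ = E * s * ((∑' n, g n) * (s * (1 - q ^ s)⁻¹)) := by ring
    _ ≤ E * s * ((∑' n, g n) * ((1 + s * L) / L)) := by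
        gcongr
        exact div_one_sub_rpow_le hq0 hq1 hs
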